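/- Fix n ≥ 1, points x₁⁺,…,xₙ⁺ ∈ ℝ and x₁⁻,…,xₙ⁻ ∈ ℝ, and ε > 0 with n·ε < Σᵢ xᵢ⁺ − Σᵢ xᵢ⁻. Let μ be a probability measure on ℝ with finite first moment. For u ∈ ℝⁿ let t(u) = (Σᵢ uᵢ + Σᵢ xᵢ⁺)/(2n) and R₁(u) = ∫ max(t(u) − x, 0) dμ(x). Then for every u ∈ ℝⁿ with |uᵢ − xᵢ⁻| ≤ ε for all i: (a) Σᵢ uᵢ < Σᵢ xᵢ⁺; (b) the point u* defined by uᵢ* = xᵢ⁻ − ε satisfies R₁(u*) ≤ R₁(u); and (c) if moreover μ((−∞, t(u*)]) > 0, then R₁(u*) < R₁(u) whenever u ≠ u*, i.e., u* is the unique global minimizer over the feasible set. (Theorem 1, small-perturbation case.) -/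

import Mathlib

open MeasureTheory Finset

/-- Raising the threshold from `a` to `b` raises `∫ max (· - x) 0` by at least
`(b - a) * μ((-∞, a])`. -/
theorem integral_max_sub_add_le {μ : Measure ℝ} [IsFiniteMeasure μ]
    (hμ : Integrable (fun x : ℝ => x) μ) {a b : ℝ} (hab : a ≤ b) :
    ∫ x, max (a - x) 0 ∂μ + (b - a) * μ.real (Set.Iic a) ≤ ∫ x, max (b - x) 0 ∂μ := by
  have hint (c : ℝ) : Integrable (fun x : ℝ => max (c - x) 0) μ :=
    ((integrable_const c).sub hμ).sup (integrable_const 0)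
  have hind : Integrable ((Set.Iic a).indicator fun _ => b - a) μ :=
    (integrable_const (b - a)).indicator measurableSet_Iic
  have hval : ∫ x, (Set.Iic a).indicator (fun _ => b - a) x ∂μ = (b - a) * μ.real (Set.Iic a) := by
    rw [integral_indicator_const _ measurableSet_Iic, smul_eq_mul, mul_comm]
  rw [← hval, ← integral_add (hint a) hind]
  refine integral_mono ((hint a).add hind) (hint b) fun x => ?_
  by_cases hx : x ≤ a
  · simp [Set.indicator, hx, hx.trans hab]
  · simp [Set.indicator, hx, (not_le.mp hx).le]

/-- Theorem 1 (small-perturbation case): if `n·ε < ∑ xp − ∑ xm`, then every feasible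
poisoning `u` (with `|uᵢ − xmᵢ| ≤ ε`) satisfies `∑ u < ∑ xp`, the point
`u* = xm − ε` is a global minimizer of the average certified radius `R₁`, and it is
the unique global minimizer provided `μ((−∞, t(u*)]) > 0`. -/
theorem theorem1_small_perturbation
    (n : ℕ) (hn : 1 ≤ n) (xp xm : Fin n → ℝ) (ε : ℝ) (hε : 0 < ε)
    (hsmall : (n : ℝ) * ε < ∑ i, xp i - ∑ i, xm i)
    (μ : Measure ℝ) [IsProbabilityMeasure μ]
    (hmoment : Integrable (fun x : ℝ => x) μ)
    (t : (Fin n → ℝ) → ℝ)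
    (ht : ∀ u, t u = (∑ i, u i + ∑ i, xp i) / (2 * n))
    (R₁ : (Fin n → ℝ) → ℝ)
    (hR₁ : ∀ u, R₁ u = ∫ x, max (t u - x) 0 ∂μ) :
    ∀ u : Fin n → ℝ, (∀ i, |u i - xm i| ≤ ε) →
      (∑ i, u i < ∑ i, xp i) ∧
      (R₁ (fun i => xm i - ε) ≤ R₁ u) ∧
      (0 < μ (Set.Iic (t (fun i => xm i - ε))) → u ≠ (fun i => xm i - ε) →
        R₁ (fun i => xm i - ε) < R₁ u) := by
  intro u hu
  have hn0 : (0 : ℝ) < 2 * n := by positivity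
  have hle (i : Fin n) : xm i - ε ≤ u i := by linarith [(abs_le.mp (hu i)).1]
  have hsum : ∑ i, u i ≤ ∑ i, xm i + n * ε := by
    calc ∑ i, u i ≤ ∑ i, (xm i + ε) :=
          Finset.sum_le_sum fun i _ => by linarith [(abs_le.mp (hu i)).2]
      _ = ∑ i, xm i + n * ε := by simp [Finset.sum_add_distrib]
  have ht_le : t (fun i => xm i - ε) ≤ t u := by
    rw [ht, ht]
    gcongr with i
    exact hle i
  have hgap := integral_max_sub_add_le hmoment ht_le
  rw [← hR₁, ← hR₁] at hgap
  refine ⟨by linarith, ?_, fun hpos hne => ?_⟩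
  · have := mul_nonneg (sub_nonneg.mpr ht_le)
      (measureReal_nonneg (μ := μ) (s := Set.Iic (t fun i => xm i - ε)))
    linarith
  · obtain ⟨j, hj⟩ := Function.ne_iff.mp hne
    have ht_lt : t (fun i => xm i - ε) < t u := by
      rw [ht, ht]
      have := Finset.sum_lt_sum (fun i _ => hle i) ⟨j, mem_univ j, (hle j).lt_of_ne' hj⟩
      gcongr
    have := mul_pos (sub_pos.mpr ht_lt) (ENNReal.toReal_pos hpos.ne' (measure_ne_top μ _))
    rw [← measureReal_def] at this
    linarith
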